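/- Let E and F be real Banach spaces, let x ∈ F, let g : F → E be continuously Fréchet differentiable on a neighborhood of x (with Fréchet derivative Dg(x) at x), and let f : E → ℝ be Lipschitz on a neighborhood of g(x). Then the Clarke subdifferential of the pullback is contained in the pullback of the Clarke subdifferential: ∂∘(f ∘ g)(x) ⊆ { ξ ∘ Dg(x) : ξ ∈ ∂∘f(g(x)) }, where ξ ∘ Dg(x) denotes the continuous linear functional on F obtained by precomposing ξ with Dg(x). -/

import Mathlib

open Filter Topology

/-- The Clarke (generalized) directional derivative of `f` at `y` in direction `w`:
`f°(y, w) = limsup_{ỹ → y, τ → 0+} (f(ỹ + τ w) − f(ỹ))/τ`. -/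
noncomputable def clarkeDeriv {E : Type*} [NormedAddCommGroup E] [NormedSpace ℝ E]
    (f : E → ℝ) (y w : E) : ℝ :=
  Filter.limsup (fun p : E × ℝ => (f (p.1 + p.2 • w) - f p.1) / p.2)
    ((𝓝 y) ×ˢ (𝓝[>] (0 : ℝ)))

/-- The Clarke subdifferential of `f` at `y`:
`∂∘f(y) = {ξ ∈ E* : ξ(w) ≤ f°(y, w) for all w}`. -/
def clarkeSubdiff {E : Type*} [NormedAddCommGroup E] [NormedSpace ℝ E]
    (f : E → ℝ) (y : E) : Set (E →L[ℝ] ℝ) :=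
  {ξ | ∀ w : E, ξ w ≤ clarkeDeriv f y w}

theorem eventually_snd_pos {X : Type*} [TopologicalSpace X] (y : X) :
    ∀ᶠ p in 𝓝 y ×ˢ 𝓝[>] (0 : ℝ), 0 < p.2 :=
  tendsto_snd.eventually self_mem_nhdsWithin

section Clarke

variable {E : Type*} [NormedAddCommGroup E] [NormedSpace ℝ E]

theorem tendsto_add_smul_nhds_prod_nhdsGT (y w : E) :
    Tendsto (fun p : E × ℝ => p.1 + p.2 • w) (𝓝 y ×ˢ 𝓝[>] (0 : ℝ)) (𝓝 y) := by
  have h : Tendsto (fun p : E × ℝ => p.1 + p.2 • w) (𝓝 y ×ˢ 𝓝 (0 : ℝ)) (𝓝 y) := by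
    rw [← nhds_prod_eq]
    exact Continuous.tendsto' (by fun_prop) _ _ (by simp)
  exact h.mono_left (Filter.prod_mono le_rfl nhdsWithin_le_nhds)

variable {f : E → ℝ} {y : E} {K : NNReal} {s : Set E}

theorem LipschitzOnWith.eventually_abs_slope_le (hf : LipschitzOnWith K f s) (hs : s ∈ 𝓝 y)
    (w : E) : ∀ᶠ p in 𝓝 y ×ˢ 𝓝[>] (0 : ℝ),
      |(f (p.1 + p.2 • w) - f p.1) / p.2| ≤ K * ‖w‖ := by
  filter_upwards [eventually_snd_pos y, tendsto_fst.eventually hs,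
    (tendsto_add_smul_nhds_prod_nhdsGT y w).eventually hs] with p hp h₁ h₂
  have h := hf.norm_sub_le h₂ h₁
  rw [add_sub_cancel_left, norm_smul, Real.norm_eq_abs, Real.norm_eq_abs, abs_of_pos hp] at h
  rw [abs_div, abs_of_pos hp, div_le_iff₀ hp]
  linarith

theorem LipschitzOnWith.clarkeDeriv_le (hf : LipschitzOnWith K f s) (hs : s ∈ 𝓝 y) {w : E} {c : ℝ}
    (h : ∀ᶠ p in 𝓝 y ×ˢ 𝓝[>] (0 : ℝ), (f (p.1 + p.2 • w) - f p.1) / p.2 ≤ c) :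
    clarkeDeriv f y w ≤ c := by
  refine limsup_le_of_le ?_ h
  refine IsBoundedUnder.isCoboundedUnder_le (isBoundedUnder_of_eventually_ge (a := -(K * ‖w‖)) ?_)
  exact (hf.eventually_abs_slope_le hs w).mono fun p hp => (abs_le.1 hp).1

theorem LipschitzOnWith.eventually_slope_lt (hf : LipschitzOnWith K f s) (hs : s ∈ 𝓝 y) {w : E}
    {c : ℝ} (h : clarkeDeriv f y w < c) :
    ∀ᶠ p in 𝓝 y ×ˢ 𝓝[>] (0 : ℝ), (f (p.1 + p.2 • w) - f p.1) / p.2 < c := by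
  refine eventually_lt_of_limsup_lt h (isBoundedUnder_of_eventually_le (a := K * ‖w‖) ?_)
  exact (hf.eventually_abs_slope_le hs w).mono fun p hp => (abs_le.1 hp).2

theorem LipschitzOnWith.clarkeDeriv_le_mul_norm (hf : LipschitzOnWith K f s) (hs : s ∈ 𝓝 y)
    (w : E) : clarkeDeriv f y w ≤ K * ‖w‖ :=
  hf.clarkeDeriv_le hs <|
    (hf.eventually_abs_slope_le hs w).mono fun _ hp => (abs_le.1 hp).2

theorem LipschitzOnWith.clarkeDeriv_add_le (hf : LipschitzOnWith K f s) (hs : s ∈ 𝓝 y)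
    (v w : E) : clarkeDeriv f y (v + w) ≤ clarkeDeriv f y v + clarkeDeriv f y w := by
  refine le_of_forall_pos_le_add fun ε hε => hf.clarkeDeriv_le hs ?_
  have hv := hf.eventually_slope_lt hs (lt_add_of_pos_right (clarkeDeriv f y v) (half_pos hε))
  have hw := hf.eventually_slope_lt hs (lt_add_of_pos_right (clarkeDeriv f y w) (half_pos hε))
  have hw' := ((tendsto_add_smul_nhds_prod_nhdsGT y v).prodMk tendsto_snd).eventually hw
  filter_upwards [hv, hw'] with p h₁ h₂
  have h : (f (p.1 + p.2 • (v + w)) - f p.1) / p.2 =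
      (f (p.1 + p.2 • v) - f p.1) / p.2 +
        (f (p.1 + p.2 • v + p.2 • w) - f (p.1 + p.2 • v)) / p.2 := by
    rw [smul_add, ← add_assoc]
    ring
  rw [h]
  linarith

theorem LipschitzOnWith.clarkeDeriv_smul_le (hf : LipschitzOnWith K f s) (hs : s ∈ 𝓝 y)
    {c : ℝ} (hc : 0 < c) (w : E) : clarkeDeriv f y (c • w) ≤ c * clarkeDeriv f y w := by
  refine le_of_forall_pos_le_add fun ε hε => hf.clarkeDeriv_le hs ?_
  have hw := hf.eventually_slope_lt hs
    (lt_add_of_pos_right (clarkeDeriv f y w) (div_pos hε hc))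
  have hmul : Tendsto (fun t : ℝ => t * c) (𝓝[>] 0) (𝓝[>] 0) := by
    refine tendsto_nhdsWithin_iff.2 ⟨?_, ?_⟩
    · exact (Continuous.tendsto' (by fun_prop) _ _ (by simp)).mono_left nhdsWithin_le_nhds
    · filter_upwards [self_mem_nhdsWithin] with t ht using mul_pos ht hc
  have hw' := (tendsto_fst.prodMk (hmul.comp tendsto_snd)).eventually hw
  filter_upwards [hw', eventually_snd_pos y] with p h₁ hp
  simp only [Function.comp_apply] at h₁
  have h : (f (p.1 + p.2 • c • w) - f p.1) / p.2 =
      c * ((f (p.1 + (p.2 * c) • w) - f p.1) / (p.2 * c)) := by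
    rw [smul_smul]
    field_simp
  have h' : c * (ε / c) = ε := by field_simp
  rw [h]
  nlinarith [mul_lt_mul_of_pos_left h₁ hc]

theorem LipschitzOnWith.clarkeDeriv_smul (hf : LipschitzOnWith K f s) (hs : s ∈ 𝓝 y)
    {c : ℝ} (hc : 0 < c) (w : E) : clarkeDeriv f y (c • w) = c * clarkeDeriv f y w := by
  refine le_antisymm (hf.clarkeDeriv_smul_le hs hc w) ?_
  have h := hf.clarkeDeriv_smul_le hs (inv_pos.2 hc) (c • w)
  rwa [inv_smul_smul₀ hc.ne', le_inv_mul_iff₀ hc] at h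

/-- Clarke's chain rule for directional derivatives. -/
theorem LipschitzOnWith.clarkeDeriv_comp_le {F : Type*} [NormedAddCommGroup F] [NormedSpace ℝ F]
    {g : F → E} {x : F} {g' : F →L[ℝ] E} (hf : LipschitzOnWith K f s) (hs : s ∈ 𝓝 (g x))
    (hg : HasStrictFDerivAt g g' x) (v : F) :
    clarkeDeriv (f ∘ g) x v ≤ clarkeDeriv f (g x) (g' v) := by
  have hgs : g ⁻¹' s ∈ 𝓝 x := hg.continuousAt hs
  obtain ⟨L, t, ht, hgL⟩ := hg.exists_lipschitzOnWith
  have hfg : LipschitzOnWith (K * L) (f ∘ g) (t ∩ g ⁻¹' s) :=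
    hf.comp (hgL.mono Set.inter_subset_left) fun _ h => h.2
  refine le_of_forall_pos_le_add fun ε hε => hfg.clarkeDeriv_le (inter_mem ht hgs) ?_
  have hgx : Tendsto (fun p : F × ℝ => g p.1) (𝓝 x ×ˢ 𝓝[>] (0 : ℝ)) (𝓝 (g x)) :=
    hg.continuousAt.tendsto.comp tendsto_fst
  have hpair : Tendsto (fun p : F × ℝ => (g p.1, p.2)) (𝓝 x ×ˢ 𝓝[>] (0 : ℝ))
      (𝓝 (g x) ×ˢ 𝓝[>] (0 : ℝ)) := hgx.prodMk tendsto_snd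
  have hslope := hpair.eventually (hf.eventually_slope_lt hs
    (lt_add_of_pos_right (clarkeDeriv f (g x) (g' v)) (half_pos hε)))
  have hlin := hpair.eventually ((tendsto_add_smul_nhds_prod_nhdsGT (g x) (g' v)).eventually hs)
  set δ : ℝ := ε / 2 / (K * ‖v‖ + 1) with hδ
  have hδpos : 0 < δ := by positivity
  have hstrict : ∀ᶠ p in 𝓝 x ×ˢ 𝓝[>] (0 : ℝ),
      ‖g (p.1 + p.2 • v) - g p.1 - g' (p.1 + p.2 • v - p.1)‖ ≤ δ * ‖p.1 + p.2 • v - p.1‖ := by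
    have h := ((tendsto_add_smul_nhds_prod_nhdsGT x v).prodMk_nhds tendsto_fst).eventually
      (hg.isLittleO.def hδpos)
    exact h
  filter_upwards [hslope, hlin, hstrict, eventually_snd_pos x,
    (tendsto_add_smul_nhds_prod_nhdsGT x v).eventually hgs] with p h₁ h₂ h₃ hp h₄
  have h₅ := hf.norm_sub_le h₄ h₂
  rw [add_sub_cancel_left, map_smul, norm_smul, Real.norm_eq_abs, abs_of_pos hp, sub_sub] at h₃
  have h₆ : K * δ * ‖v‖ ≤ ε / 2 := by
    have : δ * (K * ‖v‖ + 1) = ε / 2 := by rw [hδ]; field_simp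
    linarith
  have h₇ : f (g (p.1 + p.2 • v)) - f (g p.1 + p.2 • g' v) ≤ ε / 2 * p.2 :=
    calc f (g (p.1 + p.2 • v)) - f (g p.1 + p.2 • g' v)
        ≤ K * (δ * (p.2 * ‖v‖)) :=
          (le_abs_self _).trans (h₅.trans (mul_le_mul_of_nonneg_left h₃ K.2))
      _ = K * δ * ‖v‖ * p.2 := by ring
      _ ≤ ε / 2 * p.2 := mul_le_mul_of_nonneg_right h₆ hp.le
  rw [div_lt_iff₀ hp] at h₁
  rw [Function.comp_apply, Function.comp_apply, div_le_iff₀ hp]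
  linarith

/-- A linear functional on `F` dominated by `N ∘ A`, where `N` is sublinear and bounded by a
multiple of the norm, factors as `ξ ∘ A` with `ξ` continuous and dominated by `N`. -/
theorem exists_comp_eq_of_le_sublinear {F : Type*} [AddCommGroup F] [Module ℝ F]
    (A : F →ₗ[ℝ] E) (ζ : F →ₗ[ℝ] ℝ) (N : E → ℝ) (C : ℝ)
    (N_hom : ∀ c : ℝ, 0 < c → ∀ x, N (c • x) = c * N x)
    (N_add : ∀ x y, N (x + y) ≤ N x + N y) (N_le : ∀ x, N x ≤ C * ‖x‖)
    (hζ : ∀ v, ζ v ≤ N (A v)) :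
    ∃ ξ : E →L[ℝ] ℝ, (∀ w, ξ w ≤ N w) ∧ ∀ v, ξ (A v) = ζ v := by
  have hker : ζ ∈ (LinearMap.ker A).dualAnnihilator := by
    refine (Submodule.mem_dualAnnihilator _).2 fun v hv => ?_
    have hN : N 0 ≤ 0 := by simpa using N_le 0
    have h₁ := hζ v
    have h₂ := hζ (-v)
    rw [map_neg, map_neg, LinearMap.mem_ker.1 hv, neg_zero] at h₂
    rw [LinearMap.mem_ker.1 hv] at h₁
    linarith
  rw [← LinearMap.range_dualMap_eq_dualAnnihilator_ker] at hker
  obtain ⟨φ, rfl⟩ := hker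
  obtain ⟨ξ, hξφ, hξN⟩ := exists_extension_of_le_sublinear (φ.toPMap (LinearMap.range A)) N
    N_hom N_add (by rintro ⟨_, v, rfl⟩; exact hζ v)
  refine ⟨ξ.mkContinuous C fun w => ?_, hξN, fun v => hξφ ⟨A v, v, rfl⟩⟩
  have h := (hξN (-w)).trans (N_le (-w))
  rw [map_neg, norm_neg] at h
  exact abs_le.2 ⟨by linarith, (hξN w).trans (N_le w)⟩

end Clarke

/-- If `g : F → E` is continuously Fréchet differentiable near `x` (with derivative `Dg` at `x`)
and `f : E → ℝ` is Lipschitz on a neighborhood of `g x`, then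
`∂∘(f ∘ g)(x) ⊆ {ξ ∘ Dg : ξ ∈ ∂∘f(g x)}`. -/
theorem clarkeSubdiff_comp_subset
    {E F : Type*} [NormedAddCommGroup E] [NormedSpace ℝ E]
    [NormedAddCommGroup F] [NormedSpace ℝ F]
    (g : F → E) (f : E → ℝ) (x : F) (Dg : F →L[ℝ] E)
    (hg : ContDiffAt ℝ 1 g x) (hDg : HasFDerivAt g Dg x)
    (hf : ∃ (K : NNReal) (s : Set E), s ∈ 𝓝 (g x) ∧ LipschitzOnWith K f s) :
    clarkeSubdiff (f ∘ g) x ⊆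
      (fun ξ : E →L[ℝ] ℝ => ξ.comp Dg) '' clarkeSubdiff f (g x) := by
  obtain ⟨K, s, hs, hf⟩ := hf
  have hg' : HasStrictFDerivAt g Dg x := hg.hasStrictFDerivAt' hDg one_ne_zero
  intro ζ hζ
  obtain ⟨ξ, hξ, hξζ⟩ := exists_comp_eq_of_le_sublinear (Dg : F →ₗ[ℝ] E) (ζ : F →ₗ[ℝ] ℝ)
    (clarkeDeriv f (g x)) K (fun c hc w => hf.clarkeDeriv_smul hs hc w)
    (hf.clarkeDeriv_add_le hs) (hf.clarkeDeriv_le_mul_norm hs)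
    (fun v => (hζ v).trans (hf.clarkeDeriv_comp_le hs hg' v))
  exact ⟨ξ, hξ, ContinuousLinearMap.ext hξζ⟩
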